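/- Let λ ∈ G(e,e,n) be the diagonal matrix with λ[i,i] = ζ_e for 2 ≤ i ≤ n and λ[1,1] = ζ_e^{−(n−1)}, and fix 1 ≤ k ≤ e−1. An element w ∈ G(e,e,n) satisfies w ⪯ λ^k (i.e., ℓ(w) + ℓ(w^{−1}λ^k) = ℓ(λ^k)) if and only if for every matrix index [j,d] in Z'(w), the entry w[j,d] is 0, 1, or ζ_e^k. Here Z'(w) is the complement of Z(w) = { [j,d] : j ≤ i and d ≤ c for some bullet [i,c] }, where [i,c] is a bullet if w[i,c] is the unique possibly-nonzero entry in the upper-left rectangle { [j,d] : j ≤ i, d ≤ c }. -/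

import Mathlib

noncomputable section

open Matrix

/-- The primitive `e`-th root of unity `ζ_e = exp(2πi/e)`. -/
def zeta (e : ℕ) : ℂ := Complex.exp (2 * (Real.pi : ℂ) * Complex.I / (e : ℂ))

/-- The generator `t_i` of `G(e,e,n)`: it swaps the first two coordinates with
multipliers `ζ_e^{-i}` and `ζ_e^{i}` and is the identity elsewhere. -/
def tmat (e n i : ℕ) : Matrix (Fin n) (Fin n) ℂ :=
  Matrix.of fun p q =>
    if (p : ℕ) = 0 ∧ (q : ℕ) = 1 then (zeta e)⁻¹ ^ i
    else if (p : ℕ) = 1 ∧ (q : ℕ) = 0 then zeta e ^ i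
    else if (p : ℕ) = (q : ℕ) ∧ 2 ≤ (p : ℕ) then 1 else 0

/-- The generator `s_j` of `G(e,e,n)` (`3 ≤ j ≤ n`, 1-based): the permutation
matrix of the transposition `(j-1, j)`. -/
def smat (n j : ℕ) : Matrix (Fin n) (Fin n) ℂ :=
  Matrix.of fun p q =>
    if (p : ℕ) = j - 2 ∧ (q : ℕ) = j - 1 then 1
    else if (p : ℕ) = j - 1 ∧ (q : ℕ) = j - 2 then 1
    else if (p : ℕ) = (q : ℕ) ∧ (p : ℕ) ≠ j - 2 ∧ (p : ℕ) ≠ j - 1 then 1 else 0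

/-- The Corran–Picantin generating set `X = {t_0,…,t_{e-1}, s_3,…,s_n}`. -/
def genSet (e n : ℕ) : Set (Matrix (Fin n) (Fin n) ℂ) :=
  {M | (∃ i < e, M = tmat e n i) ∨ ∃ j, 3 ≤ j ∧ j ≤ n ∧ M = smat n j}

/-- Membership in `G(e,e,n)`: a monomial matrix whose nonzero entries are
`e`-th roots of unity with product of nonzero entries equal to `1`.
(Each row sum is the unique nonzero entry of that row.) -/
def IsGeen (e n : ℕ) (w : Matrix (Fin n) (Fin n) ℂ) : Prop :=
  (∀ i, ∃! j, w i j ≠ 0) ∧ (∀ j, ∃! i, w i j ≠ 0) ∧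
  (∀ i j, w i j ≠ 0 → w i j ^ e = 1) ∧ (∏ i, ∑ j, w i j) = 1

/-- Word length over the Corran–Picantin generating set. -/
def len (e n : ℕ) (w : Matrix (Fin n) (Fin n) ℂ) : ℕ :=
  sInf {l | ∃ L : List (Matrix (Fin n) (Fin n) ℂ),
    (∀ x ∈ L, x ∈ genSet e n) ∧ L.prod = w ∧ L.length = l}

/-- The element `λ`: diagonal with `λ[i,i] = ζ_e` for `i ≥ 2` (1-based) and
`λ[1,1] = ζ_e^{-(n-1)}`. -/
def lamMat (e n : ℕ) : Matrix (Fin n) (Fin n) ℂ :=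
  Matrix.of fun p q =>
    if p = q then (if (p : ℕ) = 0 then (zeta e)⁻¹ ^ (n - 1) else zeta e) else 0

/-- Left divisibility: `u ⪯ w` iff `w = u v` with `ℓ(u) + ℓ(v) = ℓ(w)`. -/
def LDiv (e n : ℕ) (u w : Matrix (Fin n) (Fin n) ℂ) : Prop :=
  ∃ v, IsGeen e n v ∧ u * v = w ∧ len e n u + len e n v = len e n w

/-- Right divisibility: `u ⪯_r w` iff `w = v u` with `ℓ(v) + ℓ(u) = ℓ(w)`. -/
def RDiv (e n : ℕ) (u w : Matrix (Fin n) (Fin n) ℂ) : Prop :=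
  ∃ v, IsGeen e n v ∧ v * u = w ∧ len e n v + len e n u = len e n w

/-- `[i,c]` is a bullet of `w`: every entry `w[j,d]` with `j ≤ i`, `d ≤ c`
other than `w[i,c]` itself is `0`. -/
def IsBullet (n : ℕ) (w : Matrix (Fin n) (Fin n) ℂ) (i c : Fin n) : Prop :=
  ∀ j d : Fin n, j ≤ i → d ≤ c → (j, d) ≠ (i, c) → w j d = 0

/-- `Z(w) = { [j,d] : j ≤ i and d ≤ c for some bullet [i,c] }`. -/
def Zset (n : ℕ) (w : Matrix (Fin n) (Fin n) ℂ) : Set (Fin n × Fin n) :=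
  {p | ∃ i c : Fin n, IsBullet n w i c ∧ p.1 ≤ i ∧ p.2 ≤ c}

/-- The monomial matrix whose row `p` has the entry `a p` in column `σ p`. -/
def monoMat {n : ℕ} (σ : Equiv.Perm (Fin n)) (a : Fin n → ℂ) : Matrix (Fin n) (Fin n) ℂ :=
  Matrix.of fun p q => if q = σ p then a p else 0

/-- The entries of an element of `G(e,e,n)`: `e`-th roots of unity of product `1`. -/
def GoodEntries (e : ℕ) {n : ℕ} (a : Fin n → ℂ) : Prop :=
  (∀ i, a i ^ e = 1) ∧ ∏ i, a i = 1

/-- The contribution of the rows `j < i` to the length. -/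
def pairWeight {n : ℕ} (σ : Equiv.Perm (Fin n)) (a : Fin n → ℂ) (q : Fin n × Fin n) : ℕ :=
  if q.2 < q.1 then (if σ q.1 < σ q.2 then 1 else if a q.1 = 1 then 0 else 2) else 0

/-- The combinatorial length of the monomial matrix `monoMat σ a`. -/
def monoLen {n : ℕ} (σ : Equiv.Perm (Fin n)) (a : Fin n → ℂ) : ℕ :=
  ∑ q, pairWeight σ a q

/-- The entries of a generator `t_i`, with multiplier `c`. -/
def pairEntries {n : ℕ} (p p' : Fin n) (c : ℂ) (i : Fin n) : ℂ :=
  if i = p then c⁻¹ else if i = p' then c else 1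

section Monomial

variable {n : ℕ}

theorem monoMat_mul (σ τ : Equiv.Perm (Fin n)) (a b : Fin n → ℂ) :
    monoMat σ a * monoMat τ b = monoMat (τ * σ) fun p => a p * b (σ p) := by
  ext p q
  simp only [monoMat, Matrix.mul_apply, Matrix.of_apply]
  rw [Finset.sum_eq_single (σ p) (fun j _ hj => by simp [hj]) (by simp)]
  by_cases h : q = τ (σ p) <;> simp [h]

theorem monoMat_one : monoMat (1 : Equiv.Perm (Fin n)) (fun _ => 1) = 1 := by
  ext p q
  simp [monoMat, Matrix.one_apply, eq_comm]

theorem monoMat_inj {σ τ : Equiv.Perm (Fin n)} {a b : Fin n → ℂ} (ha : ∀ i, a i ≠ 0)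
    (h : monoMat σ a = monoMat τ b) : σ = τ ∧ a = b := by
  have key : ∀ p, σ p = τ p ∧ a p = b p := by
    intro p
    have h1 := congrFun (congrFun h p) (σ p)
    simp only [monoMat, Matrix.of_apply, if_true] at h1
    by_cases hp : σ p = τ p
    · exact ⟨hp, by simpa [hp] using h1⟩
    · simp [hp, ha p] at h1
  exact ⟨Equiv.ext fun p => (key p).1, funext fun p => (key p).2⟩

theorem GoodEntries.ne_zero {e : ℕ} (he : 1 < e) {a : Fin n → ℂ} (h : GoodEntries e a)
    (i : Fin n) : a i ≠ 0 := by
  intro h0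
  have := h.1 i
  rw [h0, zero_pow (by omega)] at this
  exact zero_ne_one this

theorem GoodEntries.mul_comp {e : ℕ} {a b : Fin n → ℂ} (ha : GoodEntries e a)
    (hb : GoodEntries e b) (σ : Equiv.Perm (Fin n)) :
    GoodEntries e fun p => a p * b (σ p) := by
  refine ⟨fun i => by rw [mul_pow, ha.1, hb.1, one_mul], ?_⟩
  rw [Finset.prod_mul_distrib, ha.2, Equiv.prod_comp σ b, hb.2, one_mul]

theorem isGeen_iff {e : ℕ} (he : 1 < e) (w : Matrix (Fin n) (Fin n) ℂ) :
    IsGeen e n w ↔ ∃ σ a, GoodEntries e a ∧ w = monoMat σ a := by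
  constructor
  · rintro ⟨h1, h2, h3, h4⟩
    choose f hf hf' using h1
    have hinj : Function.Injective f := fun i j hij =>
      (h2 (f i)).unique (hf i) (by simpa [hij] using hf j)
    have hz : ∀ i j, j ≠ f i → w i j = 0 := fun i j hj => by
      by_contra h
      exact hj (hf' i j h)
    refine ⟨Equiv.ofBijective f (Finite.injective_iff_bijective.mp hinj), fun i => w i (f i),
      ⟨fun i => h3 _ _ (hf i), ?_⟩, ?_⟩
    · rw [← h4]
      refine Finset.prod_congr rfl fun i _ => ?_
      rw [Finset.sum_eq_single (f i) (fun j _ hj => hz i j hj) (by simp)]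
    · ext i j
      simp only [monoMat, Matrix.of_apply, Equiv.ofBijective_apply]
      split_ifs with h
      · rw [h]
      · exact hz i j h
  · rintro ⟨σ, a, ha, rfl⟩
    have h0 := ha.ne_zero he
    refine ⟨fun i => ⟨σ i, by simp [monoMat, h0], fun j hj => ?_⟩,
      fun j => ⟨σ.symm j, by simp [monoMat, h0], fun i hi => ?_⟩, fun i j hij => ?_, ?_⟩
    · by_contra h
      exact hj (by simp [monoMat, h])
    · by_contra h
      refine hi ?_
      have : j ≠ σ i := fun hj => h (by simp [hj])
      simp [monoMat, this]
    · by_cases h : j = σ i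
      · simp [monoMat, h, ha.1]
      · simp [monoMat, h] at hij
    · simpa [monoMat] using ha.2

theorem goodEntries_pairEntries {e : ℕ} (he : 1 < e) {p p' : Fin n} (hpp : p ≠ p') {c : ℂ}
    (hc : c ^ e = 1) : GoodEntries e (pairEntries p p' c) := by
  have hc0 : c ≠ 0 := by
    rintro rfl
    rw [zero_pow (by omega)] at hc
    exact zero_ne_one hc
  constructor
  · intro i
    unfold pairEntries
    split_ifs <;> simp [hc]
  · rw [Finset.prod_eq_mul p p' hpp (fun i _ hi => by simp [pairEntries, hi.1, hi.2])
      (by simp) (by simp)]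
    simp [pairEntries, hpp.symm, hc0]

theorem tmat_eq (e i : ℕ) {p p' : Fin n} (hp : (p : ℕ) = 0) (hp' : (p' : ℕ) = 1) :
    tmat e n i = monoMat (Equiv.swap p p') (pairEntries p p' (zeta e ^ i)) := by
  ext x y
  simp only [tmat, monoMat, pairEntries, Matrix.of_apply, Equiv.swap_apply_def, Fin.ext_iff]
  rw [inv_pow]
  grind

theorem smat_eq {j : ℕ} (hj : 3 ≤ j) {p p' : Fin n} (hp : (p : ℕ) = j - 2)
    (hp' : (p' : ℕ) = j - 1) :
    smat n j = monoMat (Equiv.swap p p') (pairEntries p p' 1) := by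
  ext x y
  simp only [smat, monoMat, pairEntries, Matrix.of_apply, Equiv.swap_apply_def, Fin.ext_iff]
  rw [inv_one]
  grind

theorem mem_genSet_iff {e : ℕ} (he : 1 < e) (hn : 2 ≤ n) (x : Matrix (Fin n) (Fin n) ℂ) :
    x ∈ genSet e n ↔ ∃ (p p' : Fin n) (c : ℂ), (p' : ℕ) = p + 1 ∧ c ^ e = 1 ∧
      ((p : ℕ) = 0 ∨ c = 1) ∧ x = monoMat (Equiv.swap p p') (pairEntries p p' c) := by
  have hprim : IsPrimitiveRoot (zeta e) e := Complex.isPrimitiveRoot_exp e (by omega)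
  constructor
  · rintro (⟨i, -, rfl⟩ | ⟨j, hj, hjn, rfl⟩)
    · refine ⟨⟨0, by omega⟩, ⟨1, by omega⟩, zeta e ^ i, rfl, ?_, Or.inl rfl,
        tmat_eq e i rfl rfl⟩
      rw [← pow_mul, mul_comm, pow_mul, hprim.pow_eq_one, one_pow]
    · exact ⟨⟨j - 2, by omega⟩, ⟨j - 1, by omega⟩, 1, by simp; omega, one_pow _, Or.inr rfl,
        smat_eq hj rfl rfl⟩
  · rintro ⟨p, p', c, hpp, hc, h, rfl⟩
    by_cases hp : (p : ℕ) = 0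
    · have : NeZero e := ⟨by omega⟩
      obtain ⟨i, hi, rfl⟩ := hprim.eq_pow_of_pow_eq_one hc
      exact Or.inl ⟨i, hi, (tmat_eq e i hp (by omega)).symm⟩
    · obtain rfl : c = 1 := h.resolve_left hp
      exact Or.inr ⟨p + 2, by omega, by omega,
        (smat_eq (by omega) (by omega) (by omega)).symm⟩

/-- Left multiplication by a generator changes only the contribution of one pair of rows. -/
theorem monoLen_swap (σ : Equiv.Perm (Fin n)) (a : Fin n → ℂ) {p p' : Fin n} {c : ℂ}
    (hpp : (p' : ℕ) = p + 1) (hc : (p : ℕ) = 0 ∨ c = 1) :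
    monoLen (σ * Equiv.swap p p') (fun i => pairEntries p p' c i * a (Equiv.swap p p' i)) +
      pairWeight σ a (p', p) =
    monoLen σ a + (if σ p < σ p' then 1 else if c * a p = 1 then 0 else 2) := by
  have hne : p' ≠ p := fun h => by rw [h] at hpp; omega
  have hlt : p < p' := by rw [Fin.lt_def]; omega
  set s := Equiv.swap p p' with hs
  set a' : Fin n → ℂ := fun i => pairEntries p p' c i * a (s i) with ha'
  have hw : pairWeight (σ * s) a' (p', p) =
      (if σ p < σ p' then 1 else if c * a p = 1 then 0 else 2) := by
    simp [pairWeight, hlt, ha', hs, pairEntries, hne]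
  rw [← hw]
  unfold monoLen
  rw [← Finset.sum_erase_add _ _ (Finset.mem_univ (p', p)),
    ← Finset.sum_erase_add _ (pairWeight σ a) (Finset.mem_univ (p', p))]
  suffices h : ∑ q ∈ Finset.univ.erase (p', p), pairWeight (σ * s) a' q =
      ∑ q ∈ Finset.univ.erase (p', p), pairWeight σ a q by
    rw [h]; ring
  rw [← Finset.sum_erase_add _ _ (show (p, p') ∈ Finset.univ.erase (p', p) by simp [hne]),
    ← Finset.sum_erase_add _ (pairWeight σ a)
      (show (p, p') ∈ Finset.univ.erase (p', p) by simp [hne])]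
  congr 1
  · refine Finset.sum_equiv (Equiv.prodCongr s s) ?_ ?_
    · rintro ⟨i, j⟩
      simp only [Finset.mem_erase, Finset.mem_univ, ne_eq, Prod.mk.injEq, and_true,
        Equiv.prodCongr_apply, Prod.map_apply, hs, Equiv.swap_apply_def]
      grind
    · rintro ⟨i, j⟩ hij
      simp only [Finset.mem_erase, Finset.mem_univ, ne_eq, Prod.mk.injEq, and_true] at hij
      have hord : s j < s i ↔ j < i := by
        simp only [hs, Equiv.swap_apply_def, Fin.lt_def]
        split_ifs <;> simp_all [Fin.ext_iff] <;> omega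
      have hent : j < i → a' i = a (s i) := by
        intro hji
        simp only [ha', pairEntries]
        rw [Fin.lt_def] at hji
        rcases hc with h | rfl
        · have h1 : i ≠ p := fun h' => by rw [h'] at hji; omega
          have h2 : i ≠ p' := fun h' => by
            subst h'
            exact hij.2 ⟨rfl, Fin.ext (by omega)⟩
          simp [h1, h2]
        · simp
      simp only [pairWeight, Equiv.prodCongr_apply, Prod.map_apply, hord, Equiv.Perm.mul_apply]
      split_ifs with h1 <;> simp_all
  · simp [pairWeight, not_lt.mpr hlt.le]

theorem generator_mul_monoMat (σ : Equiv.Perm (Fin n)) (a : Fin n → ℂ) (p p' : Fin n) (c : ℂ) :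
    monoMat (Equiv.swap p p') (pairEntries p p' c) * monoMat σ a =
      monoMat (σ * Equiv.swap p p')
        fun i => pairEntries p p' c i * a (Equiv.swap p p' i) :=
  monoMat_mul _ _ _ _

theorem generator_mul_self {p p' : Fin n} (hpp : p ≠ p') {c : ℂ} (hc : c ≠ 0) :
    monoMat (Equiv.swap p p') (pairEntries p p' c) *
      monoMat (Equiv.swap p p') (pairEntries p p' c) = 1 := by
  rw [monoMat_mul, Equiv.swap_mul_self, ← monoMat_one]
  congr 1
  ext i
  simp only [pairEntries, Equiv.swap_apply_def]
  split_ifs <;> simp_all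

theorem exists_monoMat_eq_prod {e : ℕ} (he : 1 < e) (hn : 2 ≤ n)
    (L : List (Matrix (Fin n) (Fin n) ℂ)) (hL : ∀ x ∈ L, x ∈ genSet e n) :
    ∃ σ a, GoodEntries e a ∧ L.prod = monoMat σ a ∧ monoLen σ a ≤ L.length := by
  induction L with
  | nil =>
    refine ⟨1, fun _ => 1, ⟨by simp, by simp⟩, by simp [monoMat_one], ?_⟩
    have : ∀ q : Fin n × Fin n, pairWeight 1 (fun _ => 1) q = 0 := by
      rintro ⟨i, j⟩
      simp only [pairWeight, Equiv.Perm.one_apply]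
      split_ifs with h1 h2 <;> first | rfl | exact absurd h1 (not_lt.mpr h2.le)
    simp [monoLen, this]
  | cons x L ih =>
    obtain ⟨σ, a, ha, hprod, hle⟩ := ih fun y hy => hL y (List.mem_cons_of_mem _ hy)
    obtain ⟨p, p', c, hpp, hc, h, rfl⟩ := (mem_genSet_iff he hn x).mp (hL x (by simp))
    have hne : p ≠ p' := fun h => by rw [h] at hpp; omega
    refine ⟨_, _, (goodEntries_pairEntries he hne hc).mul_comp ha (Equiv.swap p p'),
      by rw [List.prod_cons, hprod, generator_mul_monoMat], ?_⟩
    have key := monoLen_swap σ a hpp h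
    have hlt : p < p' := by rw [Fin.lt_def]; omega
    rw [List.length_cons]
    simp only [pairWeight, hlt, if_true] at key
    have hσ : σ p ≠ σ p' := fun h => hne (σ.injective h)
    rcases lt_or_gt_of_ne hσ with h | h
    · rw [if_pos h] at key
      omega
    · rw [if_pos h, if_neg (not_lt.mpr h.le)] at key
      split_ifs at key <;> omega

/-- A matrix on which no generator acts by shortening is the identity. -/
theorem eq_one_of_no_descent {e : ℕ} (he : 1 < e) (hn : 2 ≤ n) (σ : Equiv.Perm (Fin n)) {a : Fin n → ℂ}
    (ha : GoodEntries e a)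
    (h : ∀ (p p' : Fin n) (c : ℂ), (p' : ℕ) = p + 1 → c ^ e = 1 → ((p : ℕ) = 0 ∨ c = 1) →
      pairWeight σ a (p', p) ≤ (if σ p < σ p' then 1 else if c * a p = 1 then 0 else 2)) :
    monoMat σ a = 1 := by
  have key : ∀ m : ℕ, ∀ p p' : Fin n, (p : ℕ) = m → (p' : ℕ) = p + 1 →
      σ p < σ p' ∧ a p' = 1 := by
    intro m
    induction m with
    | zero =>
      intro p p' hp hpp
      have hlt : p < p' := by rw [Fin.lt_def]; omega
      have hσ : σ p ≠ σ p' := fun h => hlt.ne (σ.injective h)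
      rcases lt_or_gt_of_ne hσ with h1 | h1
      · refine ⟨h1, ?_⟩
        have := h p p' 1 hpp (one_pow _) (Or.inr rfl)
        simp only [pairWeight, hlt, if_true, h1, if_neg (not_lt.mpr h1.le)] at this
        by_contra h2
        simp [h2] at this
      · exfalso
        have hc := h p p' (a p)⁻¹ hpp (by rw [inv_pow, ha.1, inv_one]) (Or.inl hp)
        simp [pairWeight, hlt, h1, not_lt.mpr h1.le, inv_mul_cancel₀ (ha.ne_zero he p)] at hc
    | succ m ih =>
      intro p p' hp hpp
      have hlt : p < p' := by rw [Fin.lt_def]; omega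
      have hσ : σ p ≠ σ p' := fun h => hlt.ne (σ.injective h)
      obtain ⟨-, hap⟩ := ih ⟨m, by omega⟩ p rfl hp
      have := h p p' 1 hpp (one_pow _) (Or.inr rfl)
      simp only [pairWeight, hlt, if_true] at this
      rcases lt_or_gt_of_ne hσ with h1 | h1
      · refine ⟨h1, ?_⟩
        by_contra h2
        simp [h1, not_lt.mpr h1.le, h2] at this
      · simp [h1, not_lt.mpr h1.le, hap] at this
  have hmono : StrictMono σ := by
    obtain ⟨m, rfl⟩ : ∃ m, n = m + 1 := ⟨n - 1, by omega⟩
    exact Fin.strictMono_iff_lt_succ.mpr fun i => (key i _ _ rfl (by simp)).1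
  have hσ : σ = 1 := by
    ext i
    have := Subsingleton.elim (hmono.orderIsoOfSurjective σ σ.surjective) (OrderIso.refl _)
    exact congrArg Fin.val (DFunLike.congr_fun this i)
  have ha1 : ∀ i : Fin n, (i : ℕ) ≠ 0 → a i = 1 := fun i hi =>
    (key (i - 1) ⟨i - 1, by omega⟩ i rfl (by simp; omega)).2
  have ha0 : a ⟨0, by omega⟩ = 1 := by
    rw [← ha.2]
    refine (Finset.prod_eq_single _ (fun i _ hi => ha1 i fun h => hi (Fin.ext h)) ?_).symm
    simp
  have : a = fun _ => 1 := by
    ext i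
    by_cases hi : (i : ℕ) = 0
    · rw [← ha0]
      congr 1
      exact Fin.ext hi
    · exact ha1 i hi
  rw [hσ, this, monoMat_one]

theorem exists_word_of_monoMat {e : ℕ} (he : 1 < e) (hn : 2 ≤ n) (m : ℕ) :
    ∀ (σ : Equiv.Perm (Fin n)) (a : Fin n → ℂ), GoodEntries e a → monoLen σ a = m →
      ∃ L : List (Matrix (Fin n) (Fin n) ℂ),
        (∀ x ∈ L, x ∈ genSet e n) ∧ L.prod = monoMat σ a ∧ L.length ≤ m := by
  induction m using Nat.strong_induction_on with
  | _ m ih =>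
    intro σ a ha hm
    by_cases h1 : monoMat σ a = 1
    · exact ⟨[], by simp, by simp [h1], by simp⟩
    have hdesc := mt (eq_one_of_no_descent he hn σ ha) h1
    push Not at hdesc
    obtain ⟨p, p', c, hpp, hc, h, hlt⟩ := hdesc
    have hne : p ≠ p' := fun h => by rw [h] at hpp; omega
    have hc0 : c ≠ 0 := by
      rintro rfl
      rw [zero_pow (by omega)] at hc
      exact zero_ne_one hc
    have key := monoLen_swap σ a hpp h
    obtain ⟨L, hL, hprod, hlen⟩ := ih (monoLen (σ * Equiv.swap p p')
      fun i => pairEntries p p' c i * a (Equiv.swap p p' i)) (by omega) _ _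
      ((goodEntries_pairEntries he hne hc).mul_comp ha (Equiv.swap p p')) rfl
    refine ⟨monoMat (Equiv.swap p p') (pairEntries p p' c) :: L, ?_, ?_, ?_⟩
    · rintro x (_ | ⟨_, hx⟩)
      · exact (mem_genSet_iff he hn _).mpr ⟨p, p', c, hpp, hc, h, rfl⟩
      · exact hL x hx
    · rw [List.prod_cons, hprod, ← generator_mul_monoMat, ← mul_assoc,
        generator_mul_self hne hc0, one_mul]
    · rw [List.length_cons]
      omega

/-- The word length of an element of `G(e,e,n)`. -/
theorem len_monoMat {e : ℕ} (he : 1 < e) (hn : 2 ≤ n) (σ : Equiv.Perm (Fin n))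
    {a : Fin n → ℂ} (ha : GoodEntries e a) : len e n (monoMat σ a) = monoLen σ a := by
  obtain ⟨L, hL, hprod, hlen⟩ := exists_word_of_monoMat he hn _ σ a ha rfl
  have hmem : L.length ∈ {l | ∃ L : List (Matrix (Fin n) (Fin n) ℂ),
      (∀ x ∈ L, x ∈ genSet e n) ∧ L.prod = monoMat σ a ∧ L.length = l} := ⟨L, hL, hprod, rfl⟩
  refine le_antisymm ((Nat.sInf_le hmem).trans hlen) (le_csInf ⟨_, hmem⟩ ?_)
  rintro l ⟨L', hL', hprod', rfl⟩
  obtain ⟨τ, b, hb, hτ, hle⟩ := exists_monoMat_eq_prod he hn L' hL'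
  obtain ⟨rfl, rfl⟩ := monoMat_inj (ha.ne_zero he) (hprod'.symm.trans hτ)
  exact hle

/-- The diagonal of `λ^k`. -/
def lamEntries (e n k : ℕ) (i : Fin n) : ℂ :=
  (if (i : ℕ) = 0 then (zeta e)⁻¹ ^ (n - 1) else zeta e) ^ k

theorem lamMat_pow (e k : ℕ) : lamMat e n ^ k = monoMat 1 (lamEntries e n k) := by
  have : lamMat e n =
      Matrix.diagonal fun i : Fin n => if (i : ℕ) = 0 then (zeta e)⁻¹ ^ (n - 1) else zeta e := by
    ext p q
    simp [lamMat, Matrix.diagonal_apply]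
  rw [this, Matrix.diagonal_pow]
  ext p q
  by_cases h : q = p
  · simp [monoMat, lamEntries, h]
  · simp [monoMat, h, Matrix.diagonal_apply_ne' _ h]

theorem goodEntries_lamEntries {e : ℕ} (he : 1 < e) (hn : 2 ≤ n) (k : ℕ) :
    GoodEntries e (lamEntries e n k) := by
  have hz : zeta e ^ e = 1 := (Complex.isPrimitiveRoot_exp e (by omega)).pow_eq_one
  constructor
  · intro i
    unfold lamEntries
    rw [pow_right_comm]
    split_ifs
    · rw [pow_right_comm (zeta e)⁻¹, inv_pow, hz, inv_one, one_pow, one_pow]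
    · rw [hz, one_pow]
  · obtain ⟨m, rfl⟩ : ∃ m, n = m + 1 := ⟨n - 1, by omega⟩
    have h0 : zeta e ≠ 0 := Complex.exp_ne_zero _
    unfold lamEntries
    rw [Finset.prod_pow, Fin.prod_univ_succ]
    simp [h0]

theorem monoLen_lamEntries {e k : ℕ} (hz : zeta e ^ k ≠ 1) :
    monoLen 1 (lamEntries e n k) = ∑ q : Fin n × Fin n, if q.2 < q.1 then 2 else 0 := by
  refine Finset.sum_congr rfl fun ⟨i, j⟩ _ => ?_
  by_cases h1 : j < i
  · have h2 : (i : ℕ) ≠ 0 := by rw [Fin.lt_def] at h1; omega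
    simp [pairWeight, lamEntries, h1, not_lt.mpr h1.le, h2, hz]
  · simp [pairWeight, h1]

/-- The joint length of `w` and its complement `w⁻¹ λ^k`. -/
theorem monoLen_add_monoLen_complement {e k : ℕ} {σ τ : Equiv.Perm (Fin n)} {a b : Fin n → ℂ}
    (ha : ∀ i, a i ≠ 0) (hτ : τ * σ = 1) (hb : ∀ i, a i * b (σ i) = lamEntries e n k i) :
    monoLen σ a + monoLen τ b = ∑ q : Fin n × Fin n, if q.2 < q.1 then
      (if σ q.1 < σ q.2 then 2 else
        (if a q.1 = 1 then 0 else 2) + (if a q.1 = zeta e ^ k then 0 else 2)) else 0 := by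
  have hτσ : ∀ i, τ (σ i) = i := fun i => DFunLike.congr_fun hτ i
  have hb1 : ∀ i j : Fin n, j < i → (b (σ i) = 1 ↔ a i = zeta e ^ k) := by
    intro i j hji
    rw [Fin.lt_def] at hji
    have := hb i
    simp only [lamEntries, show (i : ℕ) ≠ 0 by omega, if_false] at this
    rw [← this]
    constructor
    · intro h; rw [h, mul_one]
    · intro h; exact (mul_left_cancel₀ (ha i) ((mul_one _).trans h)).symm
  have h1 : monoLen τ b =
      (∑ q : Fin n × Fin n, if q.2 < q.1 ∧ σ q.1 < σ q.2 then 1 else 0) +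
      ∑ q : Fin n × Fin n, if q.2 < q.1 ∧ σ q.2 < σ q.1 then
        (if a q.1 = zeta e ^ k then 0 else 2) else 0 := by
    rw [← (Equiv.prodComm _ _).sum_comp
      (fun q : Fin n × Fin n => if q.2 < q.1 ∧ σ q.1 < σ q.2 then 1 else 0),
      ← Finset.sum_add_distrib]
    unfold monoLen
    rw [← (Equiv.prodCongr σ σ).sum_comp]
    refine Finset.sum_congr rfl fun ⟨i, j⟩ _ => ?_
    simp only [pairWeight, Equiv.prodCongr_apply, Prod.map_apply, hτσ, Equiv.prodComm_apply,
      Prod.swap_prod_mk]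
    rcases lt_trichotomy i j with hij | rfl | hij
    · simp [hij, not_lt.mpr hij.le]
    · simp
    · simp [hij, not_lt.mpr hij.le, hb1 i j hij]
  rw [h1, monoLen, ← Finset.sum_add_distrib, ← Finset.sum_add_distrib]
  refine Finset.sum_congr rfl fun ⟨i, j⟩ _ => ?_
  simp only [pairWeight]
  by_cases hij : j < i
  · have hσ : σ i ≠ σ j := fun h => hij.ne' (σ.injective h)
    rcases lt_or_gt_of_ne hσ with h | h
    · simp [hij, h, not_lt.mpr h.le]
    · simp [hij, h, not_lt.mpr h.le]
  · simp [hij]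

theorem ldiv_monoMat_iff {e k : ℕ} (he : 1 < e) (hn : 2 ≤ n) (hz : zeta e ^ k ≠ 1)
    (σ : Equiv.Perm (Fin n)) {a : Fin n → ℂ} (ha : GoodEntries e a) :
    LDiv e n (monoMat σ a) (lamMat e n ^ k) ↔
      ∀ i j, j < i → σ j < σ i → a i = 1 ∨ a i = zeta e ^ k := by
  have hlam := goodEntries_lamEntries he hn k
  have main : ∀ τ b, τ * σ = 1 → (∀ i, a i * b (σ i) = lamEntries e n k i) →
      (monoLen σ a + monoLen τ b = monoLen 1 (lamEntries e n k) ↔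
        ∀ i j, j < i → σ j < σ i → a i = 1 ∨ a i = zeta e ^ k) := by
    intro τ b hτ hb
    rw [monoLen_add_monoLen_complement (ha.ne_zero he) hτ hb, monoLen_lamEntries hz, eq_comm,
      Finset.sum_eq_sum_iff_of_le]
    · constructor
      · intro h i j hji hσ
        have := h (i, j) (Finset.mem_univ _)
        simp only [hji, if_true, if_neg (not_lt.mpr hσ.le)] at this
        by_contra! hcon
        simp [hcon.1, hcon.2] at this
      · rintro h ⟨i, j⟩ -
        have h' := h i j
        simp only
        split_ifs with h1 h2 h3 h4 h4 <;> try rfl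
        · exact absurd (h4.symm.trans h3) hz
        · have hne : σ j ≠ σ i := fun h => h1.ne (σ.injective h)
          exact absurd (h' h1 (lt_of_le_of_ne (not_lt.mp h2) hne)) (by simp [h3, h4])
    · rintro ⟨i, j⟩ -
      simp only
      split_ifs with h1 h2 h3 h4 h4 <;> try norm_num
      exact absurd (h4.symm.trans h3) hz
  unfold LDiv
  rw [lamMat_pow, len_monoMat he hn σ ha, len_monoMat he hn 1 hlam]
  constructor
  · rintro ⟨v, hv, hmul, hlen⟩
    obtain ⟨τ, b, hb, rfl⟩ := (isGeen_iff he v).mp hv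
    rw [len_monoMat he hn τ hb] at hlen
    rw [monoMat_mul] at hmul
    obtain ⟨hτ, hab⟩ := monoMat_inj ((ha.mul_comp hb σ).ne_zero he) hmul
    exact (main τ b hτ (congrFun hab)).mp hlen
  · intro h
    set b : Fin n → ℂ := fun q => (a (σ⁻¹ q))⁻¹ * lamEntries e n k (σ⁻¹ q) with hbdef
    have hab : ∀ i, a i * b (σ i) = lamEntries e n k i := by
      intro i
      simp [hbdef, mul_inv_cancel_left₀ (ha.ne_zero he i)]
    have hb : GoodEntries e b := by
      constructor
      · intro i
        simp only [hbdef]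
        rw [mul_pow, inv_pow, ha.1, hlam.1, inv_one, one_mul]
      · simp only [hbdef]
        rw [Equiv.prod_comp σ⁻¹ (fun i => (a i)⁻¹ * lamEntries e n k i), Finset.prod_mul_distrib,
          Finset.prod_inv_distrib, ha.2, hlam.2, inv_one, one_mul]
    refine ⟨monoMat σ⁻¹ b, (isGeen_iff he _).mpr ⟨_, _, hb, rfl⟩, ?_, ?_⟩
    · rw [monoMat_mul, inv_mul_cancel]
      exact congrArg _ (funext hab)
    · rw [len_monoMat he hn _ hb]
      exact (main _ _ (inv_mul_cancel σ) hab).mpr h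

theorem notMem_Zset_monoMat_iff (σ : Equiv.Perm (Fin n)) {a : Fin n → ℂ} (ha : ∀ i, a i ≠ 0)
    (i : Fin n) : (i, σ i) ∉ Zset n (monoMat σ a) ↔ ∃ j, j < i ∧ σ j < σ i := by
  rw [← not_iff_not, not_not]
  constructor
  · rintro ⟨i', c, hbul, hi, hc⟩ ⟨j, hj, hσ⟩
    have h1 := hbul j (σ j) (hj.le.trans hi) (hσ.le.trans hc)
      fun h => by
        rw [Prod.mk.injEq] at h
        exact absurd (h.1 ▸ hj) (not_lt.mpr hi)
    simp [monoMat, ha] at h1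
  · intro h
    push Not at h
    refine ⟨i, σ i, fun j d hj hd hne => ?_, le_rfl, le_rfl⟩
    by_contra h0
    have hdj : d = σ j := by
      by_contra h'
      simp [monoMat, h'] at h0
    subst hdj
    rcases hj.lt_or_eq with hlt | rfl
    · exact hlt.ne (σ.injective (le_antisymm hd (h j hlt)))
    · exact hne rfl

end Monomial

/-- `w ⪯ λ^k` if and only if every entry of `w` at an index
outside `Z(w)` (i.e. in `Z'(w)`) is `0`, `1`, or `ζ_e^k`. -/
theorem statement7 (e n k : ℕ) (he : 1 < e) (hn : 2 ≤ n)
    (hk1 : 1 ≤ k) (hk : k ≤ e - 1)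
    (w : Matrix (Fin n) (Fin n) ℂ) (hw : IsGeen e n w) :
    LDiv e n w (lamMat e n ^ k) ↔
      ∀ j d : Fin n, (j, d) ∉ Zset n w →
        w j d = 0 ∨ w j d = 1 ∨ w j d = zeta e ^ k := by
  obtain ⟨σ, a, ha, rfl⟩ := (isGeen_iff he w).mp hw
  have hz : zeta e ^ k ≠ 1 :=
    (Complex.isPrimitiveRoot_exp e (by omega)).pow_ne_one_of_pos_of_lt (by omega) (by omega)
  have h0 := ha.ne_zero he
  rw [ldiv_monoMat_iff he hn hz σ ha]
  constructor
  · intro h i d hid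
    by_cases hd : d = σ i
    · subst hd
      obtain ⟨j, hj, hσ⟩ := (notMem_Zset_monoMat_iff σ h0 i).mp hid
      right
      simpa [monoMat] using h i j hj hσ
    · left
      simp [monoMat, hd]
  · intro h i j hj hσ
    simpa [monoMat, h0 i] using h i (σ i) ((notMem_Zset_monoMat_iff σ h0 i).mpr ⟨j, hj, hσ⟩)
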